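/- Let f, g ∈ ℤ[x] be monic polynomials, p a prime, and let t ∈ 𝔽_p be a simple root of the reduction of R_{f,g} modulo p (i.e. t is a root of R_{f,g} mod p of multiplicity one). Then there exist r, s ∈ 𝔽_p such that f(r) ≡ 0 (mod p), g(s) ≡ 0 (mod p), and t = r + s. -/

import Mathlib

open Polynomial

/-- The Sylvester matrix of two polynomials `f` and `g`, regarded as having degrees
`n` and `m` respectively: the first `m` rows contain the coefficients of `f`
(in descending order, shifted), the last `n` rows those of `g`. -/
noncomputable def sylvester {R : Type*} [CommRing R] (n m : ℕ) (f g : R[X]) :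
    Matrix (Fin (m + n)) (Fin (m + n)) R :=
  Matrix.of fun i j =>
    if (i : ℕ) < m then
      (if (j : ℕ) ≤ n + (i : ℕ) then f.coeff (n + (i : ℕ) - (j : ℕ)) else 0)
    else
      (if (j : ℕ) ≤ m + ((i : ℕ) - m) then g.coeff (m + ((i : ℕ) - m) - (j : ℕ)) else 0)

/-- The resultant of two polynomials `f` and `g`, regarded as having degrees
`n` and `m` respectively: the determinant of their Sylvester matrix. -/
noncomputable def resultant {R : Type*} [CommRing R] (n m : ℕ) (f g : R[X]) : R :=
  (sylvester n m f g).det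

/-- `Rres f g` is the polynomial `R_{f,g}(y) = Res_x(f(x), g(y - x))`, the resultant with
respect to the variable `x` of `f(x)` and `g(y - x)`, viewed as a polynomial in `y`. -/
noncomputable def Rres {R : Type*} [CommRing R] (f g : R[X]) : R[X] :=
  resultant f.natDegree g.natDegree (f.map (C : R →+* R[X]))
    ((g.map (C : R →+* R[X])).comp (C X - X))

/-- The Sylvester matrix of the statement is Mathlib's one, transposed and with both index sets
reversed. -/
lemma sylvester_eq_submatrix {R : Type*} [CommRing R] {n m : ℕ} {f g : R[X]}
    (hf : f.natDegree ≤ n) (hg : g.natDegree ≤ m) :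
    _root_.sylvester n m f g =
      (Polynomial.sylvester f g n m).transpose.submatrix
        (Fin.revPerm.trans (finCongr (add_comm m n)))
        (Fin.revPerm.trans (finCongr (add_comm m n))) := by
  ext i j
  obtain ⟨i, rfl⟩ := (Fin.revPerm.trans (finCongr (add_comm m n))).symm.surjective i
  rw [Matrix.submatrix_apply, Equiv.apply_symm_apply, Matrix.transpose_apply]
  have hj := j.isLt
  induction i using Fin.addCases with
  | left i =>
    have hi := i.isLt
    simp only [_root_.sylvester, Polynomial.sylvester, Matrix.of_apply, Fin.addCases_left,
      Set.mem_Icc, Equiv.trans_apply, Equiv.symm_trans_apply, finCongr_apply,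
      finCongr_symm, Fin.revPerm_apply, Fin.revPerm_symm, Fin.val_cast, Fin.val_rev,
      Fin.val_castAdd]
    rw [if_neg (by omega)]
    split_ifs
    · congr 1; omega
    · exact coeff_eq_zero_of_natDegree_lt (by omega)
    · omega
    · rfl
  | right i =>
    have hi := i.isLt
    simp only [_root_.sylvester, Polynomial.sylvester, Matrix.of_apply, Fin.addCases_right,
      Set.mem_Icc, Equiv.trans_apply, Equiv.symm_trans_apply, finCongr_apply,
      finCongr_symm, Fin.revPerm_apply, Fin.revPerm_symm, Fin.val_cast, Fin.val_rev,
      Fin.val_natAdd]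
    rw [if_pos (by omega)]
    split_ifs
    · congr 1; omega
    · exact coeff_eq_zero_of_natDegree_lt (by omega)
    · omega
    · rfl

lemma resultant_eq_polynomial_resultant {R : Type*} [CommRing R] {n m : ℕ} {f g : R[X]}
    (hf : f.natDegree ≤ n) (hg : g.natDegree ≤ m) :
    _root_.resultant n m f g = Polynomial.resultant f g n m := by
  rw [_root_.resultant, sylvester_eq_submatrix hf hg, Matrix.det_submatrix_equiv_self,
    Matrix.det_transpose, Polynomial.resultant]

lemma natDegree_comp_C_X_sub_X_le {R : Type*} [CommRing R] (g : R[X]) :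
    ((g.map (C : R →+* R[X])).comp (C X - X)).natDegree ≤ g.natDegree := by
  refine natDegree_comp_le.trans ?_
  have h : (C X - X : R[X][X]).natDegree ≤ 1 := by compute_degree
  exact (Nat.mul_le_mul natDegree_map_le h).trans (by rw [mul_one])

lemma Rres_eq_polynomial_resultant {R : Type*} [CommRing R] (f g : R[X]) :
    Rres f g = Polynomial.resultant (f.map (C : R →+* R[X]))
      ((g.map (C : R →+* R[X])).comp (C X - X)) f.natDegree g.natDegree :=
  resultant_eq_polynomial_resultant natDegree_map_le (natDegree_comp_C_X_sub_X_le g)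

lemma Rres_map {R S : Type*} [CommRing R] [CommRing S] [Nontrivial S] (φ : R →+* S) {f g : R[X]}
    (hf : f.Monic) (hg : g.Monic) : (Rres f g).map φ = Rres (f.map φ) (g.map φ) := by
  have hC (h : R[X]) :
      (h.map (C : R →+* R[X])).map (mapRingHom φ) = (h.map φ).map (C : S →+* S[X]) := by
    rw [map_map, map_map, mapRingHom_comp_C]
  rw [Rres_eq_polynomial_resultant, Rres_eq_polynomial_resultant, hf.natDegree_map,
    hg.natDegree_map, ← coe_mapRingHom, ← resultant_map_map, map_comp, hC, hC, Polynomial.map_sub, map_C,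
    map_X, coe_mapRingHom, map_X]

lemma Rres_eq_prod_comp {R : Type*} [CommRing R] [IsDomain R] {f : R[X]} (hf : f.Monic)
    (hs : f.Splits) (g : R[X]) :
    Rres f g = (f.roots.map fun a => g.comp (X - C a)).prod := by
  have key := resultant_eq_prod_eval (f.map (C : R →+* R[X]))
    ((g.map (C : R →+* R[X])).comp (C X - X)) g.natDegree (natDegree_comp_C_X_sub_X_le g)
    (hs.map C)
  rw [natDegree_map_eq_of_injective C_injective, (hf.map C).leadingCoeff, one_pow, one_mul,
    hs.roots_map_of_injective C_injective, Multiset.map_map] at key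
  rw [Rres_eq_polynomial_resultant, key]
  congr 2
  ext1 a
  simp only [Function.comp_apply, eval_comp, eval_map, eval_sub, eval_C, eval_X]
  rfl

lemma exists_unique_root_of_rootMultiplicity_Rres_eq_one {K : Type*} [Field K] {f g : K[X]}
    (hf : f.Monic) (hg : g.Monic) (hs : f.Splits) {t : K}
    (ht : (Rres f g).rootMultiplicity t = 1) :
    ∃! a : K, f.IsRoot a ∧ g.IsRoot (t - a) := by
  rw [Rres_eq_prod_comp hf hs] at ht
  have hmonic : (f.roots.map fun a => g.comp (X - C a)).prod.Monic :=
    monic_multiset_prod_of_monic _ _ fun a _ => hg.comp_X_sub_C a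
  have hroot : IsRoot (f.roots.map fun a => g.comp (X - C a)).prod t :=
    (rootMultiplicity_pos hmonic.ne_zero).1 (by omega)
  rw [IsRoot.def, eval_multiset_prod, Multiset.prod_eq_zero_iff] at hroot
  simp only [Multiset.map_map, Multiset.mem_map, Function.comp_apply, eval_comp, eval_sub,
    eval_X, eval_C] at hroot
  obtain ⟨a, ha, hga⟩ := hroot
  refine ⟨a, ⟨isRoot_of_mem_roots ha, hga⟩, fun b ⟨hb, hgb⟩ => ?_⟩
  by_contra hab
  obtain ⟨s, hfs⟩ := Multiset.exists_cons_of_mem ha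
  have hbs : b ∈ s := by
    have hb' : b ∈ f.roots := (mem_roots hf.ne_zero).2 hb
    rw [hfs, Multiset.mem_cons] at hb'
    exact hb'.resolve_left hab
  obtain ⟨s', rfl⟩ := Multiset.exists_cons_of_mem hbs
  have hdvd {c : K} (hc : g.IsRoot (t - c)) : X - C t ∣ g.comp (X - C c) := by
    rw [dvd_iff_isRoot, IsRoot.def, eval_comp]
    simpa using hc
  have h2 : 2 ≤ (f.roots.map fun a => g.comp (X - C a)).prod.rootMultiplicity t := by
    rw [le_rootMultiplicity_iff hmonic.ne_zero, hfs, Multiset.map_cons, Multiset.map_cons,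
      Multiset.prod_cons, Multiset.prod_cons, ← mul_assoc, sq]
    exact (mul_dvd_mul (hdvd hga) (hdvd hgb)).mul_right _
  omega

/-- for monic `f, g ∈ ℤ[x]`, a prime `p`, and `t ∈ 𝔽_p` a simple root (a root
of multiplicity one) of the reduction of `R_{f,g}` modulo `p`, there exist `r, s ∈ 𝔽_p`
with `f(r) ≡ 0`, `g(s) ≡ 0 (mod p)` and `t = r + s`. -/
theorem stmt8 (f g : ℤ[X]) (hf : f.Monic) (hg : g.Monic) (p : ℕ) (hp : p.Prime)
    (t : ZMod p)
    (ht : ((Rres f g).map (Int.castRingHom (ZMod p))).rootMultiplicity t = 1) :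
    ∃ r s : ZMod p, Polynomial.aeval r f = 0 ∧ Polynomial.aeval s g = 0 ∧ t = r + s := by
  have : Fact p.Prime := ⟨hp⟩
  let K := AlgebraicClosure (ZMod p)
  let ι : ZMod p →+* K := algebraMap (ZMod p) K
  rw [eq_rootMultiplicity_map ι.injective, map_map,
    RingHom.ext_int (ι.comp (Int.castRingHom (ZMod p))) (Int.castRingHom K),
    Rres_map _ hf hg] at ht
  obtain ⟨a, ⟨hfa, hga⟩, huniq⟩ := exists_unique_root_of_rootMultiplicity_Rres_eq_one
    (hf.map _) (hg.map _) (IsAlgClosed.splits _) ht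
  simp only [IsRoot.def, eval_map] at hfa hga huniq
  have : CharP K p := charP_of_injective_algebraMap ι.injective p
  have hfrob {h : ℤ[X]} {x : K} (hx : eval₂ (Int.castRingHom K) x h = 0) :
      eval₂ (Int.castRingHom K) (x ^ p) h = 0 := by
    rw [← frobenius_def, RingHom.ext_int (Int.castRingHom K) ((frobenius K p).comp _),
      ← hom_eval₂, hx, map_zero]
  have hfix : a ^ p = a := by
    refine huniq _ ⟨hfrob hfa, ?_⟩
    rw [← ZMod.pow_card t, map_pow, ← sub_pow_char]
    exact hfrob hga
  obtain ⟨r, rfl⟩ : ∃ r, ι r = a := by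
    obtain ⟨n, hn⟩ :=
      (mem_bot_iff_intCast p K).1 ((Subfield.mem_bot_iff_pow_eq_self K p).2 hfix)
    exact ⟨n, by rw [map_intCast, hn]⟩
  have hdesc {h : ℤ[X]} {x : ZMod p} (hx : eval₂ (Int.castRingHom K) (ι x) h = 0) :
      aeval x h = 0 := by
    rw [← map_eq_zero ι, aeval_def, hom_eval₂, RingHom.ext_int (ι.comp _) (Int.castRingHom K), hx]
  exact ⟨r, t - r, hdesc hfa, hdesc (by rwa [map_sub]), by ring⟩
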